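/- For every T > 0, ∫_0^T ∫_ℝ ( ∫_0^{T−r} p′_s(v) ds )² dv dr = 8(√2 − 1) T^{3/2} / (3√π). -/

import Mathlib

open MeasureTheory intervalIntegral

noncomputable section

/-- The one-dimensional heat kernel `p_t(v) = (2πt)^{-1/2} exp(-v²/(2t))`. -/
def heat1 (t v : ℝ) : ℝ :=
  (2 * Real.pi * t) ^ (-(1 : ℝ) / 2) * Real.exp (-v ^ 2 / (2 * t))

/-- Its spatial derivative `p′_t(v) = -(v/t) p_t(v)`. -/
def heat1' (t v : ℝ) : ℝ := -(v / t) * heat1 t v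

lemma aux_sq_int (b : ℝ) (hb : 0 < b) :
    Integrable (fun v : ℝ => v ^ 2 * Real.exp (-b * v ^ 2)) := by
  have h := integrable_rpow_mul_exp_neg_mul_sq hb (s := 2) (by norm_num)
  simpa using h

lemma aux_sq (b : ℝ) (hb : 0 < b) :
    ∫ v : ℝ, v ^ 2 * Real.exp (-b * v ^ 2) = (2 * b)⁻¹ * Real.sqrt (Real.pi / b) := by
  have h1 := integrable_exp_neg_mul_sq hb
  have h2 := aux_sq_int b hb
  have h3 := integrable_mul_exp_neg_mul_sq hb
  have hd : ∀ x : ℝ, HasDerivAt (fun v : ℝ => v * Real.exp (-b * v ^ 2))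
      (Real.exp (-b * x ^ 2) - (2 * b) * (x ^ 2 * Real.exp (-b * x ^ 2))) x := by
    intro x
    have e : HasDerivAt (fun v : ℝ => -b * v ^ 2) (-b * (2 * x)) x := by
      simpa using (hasDerivAt_pow 2 x).const_mul (-b)
    have := (hasDerivAt_id x).mul e.exp
    refine this.congr_deriv ?_
    simp only [id]
    ring
  have h4 := integral_eq_zero_of_hasDerivAt_of_integrable hd
    (h1.sub (h2.const_mul (2 * b))) h3
  rw [integral_sub h1 (h2.const_mul (2 * b)), MeasureTheory.integral_const_mul,
    integral_gaussian] at h4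
  generalize (∫ v : ℝ, v ^ 2 * Real.exp (-b * v ^ 2)) = I at *
  rw [eq_inv_mul_iff_mul_eq₀ (by positivity)]
  linarith

lemma aux_prod (s t : ℝ) (hs : 0 < s) (ht : 0 < t) (v : ℝ) :
    heat1' s v * heat1' t v
      = ((s * t)⁻¹ * ((2 * Real.pi)⁻¹ * (Real.sqrt s)⁻¹ * (Real.sqrt t)⁻¹)) *
        (v ^ 2 * Real.exp (-((s + t) / (2 * s * t)) * v ^ 2)) := by
  have key : ∀ u : ℝ, 0 < u → (2 * Real.pi * u) ^ (-(1 : ℝ) / 2)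
      = (Real.sqrt (2 * Real.pi))⁻¹ * (Real.sqrt u)⁻¹ := by
    intro u hu
    have hp := Real.pi_pos
    rw [neg_div, Real.rpow_neg (by positivity), ← Real.sqrt_eq_rpow,
      Real.sqrt_mul (by positivity), mul_inv]
  have he : Real.exp (-((s + t) / (2 * s * t)) * v ^ 2)
      = Real.exp (-v ^ 2 / (2 * s)) * Real.exp (-v ^ 2 / (2 * t)) := by
    rw [← Real.exp_add]
    congr 1
    field_simp
    ring
  have hp : (2 * Real.pi)⁻¹ = (Real.sqrt (2 * Real.pi))⁻¹ * (Real.sqrt (2 * Real.pi))⁻¹ := by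
    rw [← mul_inv, Real.mul_self_sqrt (by positivity)]
  unfold heat1' heat1
  rw [he, key s hs, key t ht, hp, mul_inv]
  ring

lemma aux_prod_int (s t : ℝ) (hs : 0 < s) (ht : 0 < t) :
    Integrable (fun v => heat1' s v * heat1' t v) := by
  simp_rw [aux_prod s t hs ht]
  exact (aux_sq_int _ (by positivity)).const_mul _

lemma aux_prod_nonneg (s t : ℝ) (hs : 0 < s) (ht : 0 < t) (v : ℝ) :
    0 ≤ heat1' s v * heat1' t v := by
  rw [aux_prod s t hs ht]
  have := Real.pi_pos
  positivity

lemma aux_prod_val (s t : ℝ) (hs : 0 < s) (ht : 0 < t) :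
    ∫ v, heat1' s v * heat1' t v
      = (Real.sqrt (2 * Real.pi))⁻¹ * (s + t) ^ (-(3 : ℝ) / 2) := by
  simp_rw [aux_prod s t hs ht]
  have hp := Real.pi_pos
  have hst : 0 < s + t := by positivity
  rw [MeasureTheory.integral_const_mul, aux_sq _ (by positivity)]
  have e1 : Real.pi / ((s + t) / (2 * s * t)) = (2 * Real.pi) * (s * t) / (s + t) := by
    field_simp
  have e2 : (s + t) ^ (-(3 : ℝ) / 2) = (s + t)⁻¹ * (Real.sqrt (s + t))⁻¹ := by
    rw [show (-(3 : ℝ) / 2) = (-1) + (-(1 / 2)) by norm_num, Real.rpow_add hst,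
      Real.rpow_neg_one, Real.rpow_neg hst.le, ← Real.sqrt_eq_rpow]
  rw [e1, e2, Real.sqrt_div (by positivity), Real.sqrt_mul (by positivity),
    Real.sqrt_mul hs.le]
  have hq : (2 * Real.pi)⁻¹ = (Real.sqrt (2 * Real.pi))⁻¹ * (Real.sqrt (2 * Real.pi))⁻¹ := by
    rw [← mul_inv, Real.mul_self_sqrt (by positivity)]
  rw [hq]
  have : 0 < Real.sqrt (2 * Real.pi) := by positivity
  have : 0 < Real.sqrt s := by positivity
  have : 0 < Real.sqrt t := by positivity
  have : 0 < Real.sqrt (s + t) := by positivity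
  generalize Real.sqrt (2 * Real.pi) = q at *
  field_simp

lemma aux_inner (a s : ℝ) (ha : 0 < a) (hs : 0 < s) :
    ∫ t in Set.Ioc 0 a, (s + t) ^ (-(3 : ℝ) / 2)
      = 2 * (s ^ (-(1 : ℝ) / 2) - (s + a) ^ (-(1 : ℝ) / 2)) := by
  rw [← intervalIntegral.integral_of_le ha.le,
    intervalIntegral.integral_comp_add_left (fun x => x ^ (-(3 : ℝ) / 2)) s, integral_rpow]
  · norm_num
    ring
  · right
    refine ⟨by norm_num, ?_⟩
    rw [Set.uIcc_of_le (by linarith)]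
    intro h
    have := h.1
    linarith

lemma aux_int1 (a : ℝ) :
    IntervalIntegrable (fun s : ℝ => s ^ (-(1 : ℝ) / 2)) volume 0 a :=
  intervalIntegral.intervalIntegrable_rpow' (by norm_num)

lemma aux_int2 (a : ℝ) :
    IntervalIntegrable (fun s : ℝ => (s + a) ^ (-(1 : ℝ) / 2)) volume 0 a := by
  have h : IntervalIntegrable (fun s : ℝ => s ^ (-(1 : ℝ) / 2)) volume a (a + a) :=
    intervalIntegral.intervalIntegrable_rpow' (by norm_num)
  simpa using h.comp_add_right a

lemma aux_int (a : ℝ) (ha : 0 < a) :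
    Integrable (fun z : ℝ × ℝ => (z.1 + z.2) ^ (-(3 : ℝ) / 2))
      ((volume.restrict (Set.Ioc 0 a)).prod (volume.restrict (Set.Ioc 0 a))) := by
  have hm : Measurable (fun z : ℝ × ℝ => (z.1 + z.2) ^ (-(3 : ℝ) / 2)) := by fun_prop
  rw [integrable_prod_iff hm.aestronglyMeasurable]
  constructor
  · refine (ae_restrict_mem measurableSet_Ioc).mono fun s hs => ?_
    have hc : ContinuousOn (fun t : ℝ => (s + t) ^ (-(3 : ℝ) / 2)) (Set.Icc 0 a) := by
      refine ContinuousOn.rpow_const (by fun_prop) fun t ht => Or.inl ?_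
      have := hs.1
      have := ht.1
      linarith
    exact hc.integrableOn_Icc.mono_set Set.Ioc_subset_Icc_self
  · have h : IntegrableOn (fun s : ℝ => 2 * (s ^ (-(1 : ℝ) / 2) - (s + a) ^ (-(1 : ℝ) / 2)))
        (Set.Ioc 0 a) := by
      have := ((aux_int1 a).sub (aux_int2 a)).const_mul 2
      rwa [intervalIntegrable_iff_integrableOn_Ioc_of_le ha.le] at this
    refine h.congr ?_
    refine (ae_restrict_mem measurableSet_Ioc).mono fun s hs => ?_
    simp only
    rw [← aux_inner a s ha hs.1]
    refine setIntegral_congr_fun measurableSet_Ioc fun t ht => ?_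
    have := hs.1
    have := ht.1
    exact (Real.norm_of_nonneg (by positivity)).symm

lemma aux_val (a : ℝ) (ha : 0 < a) :
    ∫ z : ℝ × ℝ, (z.1 + z.2) ^ (-(3 : ℝ) / 2)
      ∂((volume.restrict (Set.Ioc 0 a)).prod (volume.restrict (Set.Ioc 0 a)))
      = 4 * (2 - Real.sqrt 2) * Real.sqrt a := by
  rw [integral_prod _ (aux_int a ha)]
  rw [setIntegral_congr_fun measurableSet_Ioc (fun s hs => aux_inner a s ha hs.1),
    ← intervalIntegral.integral_of_le ha.le, intervalIntegral.integral_const_mul,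
    intervalIntegral.integral_sub (aux_int1 a) (aux_int2 a),
    intervalIntegral.integral_comp_add_right (fun x => x ^ (-(1 : ℝ) / 2)) a,
    integral_rpow (Or.inl (by norm_num)), integral_rpow (Or.inl (by norm_num))]
  rw [show (-(1 : ℝ) / 2 + 1) = 1 / 2 by norm_num]
  simp only [← Real.sqrt_eq_rpow]
  rw [zero_add, ← two_mul, Real.sqrt_mul (by norm_num), Real.sqrt_zero]
  ring

lemma aux_meas : Measurable (fun z : ℝ × ℝ => heat1' z.1 z.2) := by
  unfold heat1' heat1
  fun_prop

lemma aux_space (a : ℝ) (ha : 0 < a) :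
    ∫ v : ℝ, (∫ s in (0 : ℝ)..a, heat1' s v) ^ 2
      = (4 * (Real.sqrt 2 - 1) / Real.sqrt Real.pi) * Real.sqrt a := by
  set μ := (volume.restrict (Set.Ioc (0 : ℝ) a)) with hμ
  have hpos : ∀ᵐ z ∂(μ.prod μ), 0 < z.1 ∧ 0 < z.2 := by
    rw [hμ, Measure.prod_restrict]
    refine (ae_restrict_mem (measurableSet_Ioc.prod measurableSet_Ioc)).mono fun z hz => ?_
    exact ⟨hz.1.1, hz.2.1⟩
  have h1 : ∀ v : ℝ, (∫ s in (0 : ℝ)..a, heat1' s v) ^ 2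
      = ∫ z : ℝ × ℝ, heat1' z.1 v * heat1' z.2 v ∂(μ.prod μ) := by
    intro v
    rw [integral_prod_mul (fun s => heat1' s v) (fun s => heat1' s v),
      intervalIntegral.integral_of_le ha.le, sq]
  simp_rw [h1]
  have hm : Measurable (fun p : ℝ × (ℝ × ℝ) => heat1' p.2.1 p.1 * heat1' p.2.2 p.1) := by
    exact (aux_meas.comp (by fun_prop : Measurable fun p : ℝ × (ℝ × ℝ) => (p.2.1, p.1))).mul
      (aux_meas.comp (by fun_prop : Measurable fun p : ℝ × (ℝ × ℝ) => (p.2.2, p.1)))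
  have hI : Integrable (fun p : ℝ × (ℝ × ℝ) => heat1' p.2.1 p.1 * heat1' p.2.2 p.1)
      ((volume : Measure ℝ).prod (μ.prod μ)) := by
    rw [integrable_prod_iff' hm.aestronglyMeasurable]
    constructor
    · exact hpos.mono fun z hz => aux_prod_int z.1 z.2 hz.1 hz.2
    · refine ((aux_int a ha).const_mul (Real.sqrt (2 * Real.pi))⁻¹).congr ?_
      refine hpos.mono fun z hz => ?_
      simp only
      rw [← aux_prod_val z.1 z.2 hz.1 hz.2]
      congr 1
      ext v
      exact (Real.norm_of_nonneg (aux_prod_nonneg z.1 z.2 hz.1 hz.2 v)).symm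
  rw [integral_integral_swap hI,
    integral_congr_ae (hpos.mono fun z hz => aux_prod_val z.1 z.2 hz.1 hz.2),
    MeasureTheory.integral_const_mul, aux_val a ha, Real.sqrt_mul (by norm_num)]
  have h2 : Real.sqrt 2 * Real.sqrt 2 = 2 := Real.mul_self_sqrt (by norm_num)
  have : 0 < Real.sqrt Real.pi := Real.sqrt_pos.mpr Real.pi_pos
  have : 0 < Real.sqrt 2 := by positivity
  field_simp
  linear_combination -h2

theorem integral_sq_time_integral_heat_kernel_deriv (T : ℝ) (hT : 0 < T) :
    (∫ r in (0 : ℝ)..T, ∫ v : ℝ, (∫ s in (0 : ℝ)..(T - r), heat1' s v) ^ 2)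
      = 8 * (Real.sqrt 2 - 1) * T ^ ((3 : ℝ) / 2) / (3 * Real.sqrt Real.pi) := by
  rw [intervalIntegral.integral_comp_sub_left
    (fun a => ∫ v : ℝ, (∫ s in (0 : ℝ)..a, heat1' s v) ^ 2) T, sub_self, sub_zero,
    intervalIntegral.integral_of_le hT.le,
    setIntegral_congr_fun measurableSet_Ioc (fun a ha => aux_space a ha.1),
    ← intervalIntegral.integral_of_le hT.le, intervalIntegral.integral_const_mul]
  simp_rw [Real.sqrt_eq_rpow _]
  rw [integral_rpow (Or.inl (by norm_num))]
  norm_num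
  have : 0 < Real.pi ^ ((1 : ℝ) / 2) := Real.rpow_pos_of_pos Real.pi_pos _
  field_simp
  ring
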